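/- (Abstract Composition Formula, Theorem 4.3.) Let R be a commutative ring, let ι and κ be finite types with decidable equality, fix distinguished elements a : ι and b : κ, and let e ∈ R, f : Finset ι → R, g : Finset κ → R, and m : Finset ι → Finset κ → R. Assume that for all S : Finset ι with a ∉ S and all T : Finset κ with b ∉ T one has (e−1) · m(S,T) = e · f(S) · g(T) + f(insert a S) · g(insert b T) − f(S) · g(insert b T) − f(insert a S) · g(T). Then (e−1) · ∑_{S ⊆ univ.erase a} ∑_{T ⊆ univ.erase b} (−1)^{(|ι|+|κ|−1)−(|S|+|T|)} · ( f(S) · g(T) − m(S,T) ) = ( ∑_{S ⊆ (univ : Finset ι)} (−1)^{|ι|−|S|} · f(S) ) · ( ∑_{T ⊆ (univ : Finset κ)} (−1)^{|κ|−|T|} · g(T) ). -/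

import Mathlib

/-- An alternating sum over all subsets, paired up along a distinguished element `a`. -/
theorem sum_powerset_univ_alternating_eq {R : Type*} [CommRing R] {ι : Type*}
    [Fintype ι] [DecidableEq ι] (a : ι) (f : Finset ι → R) :
    ∑ S ∈ (Finset.univ : Finset ι).powerset, (-1 : R) ^ (Fintype.card ι - S.card) * f S =
      ∑ S ∈ (Finset.univ.erase a).powerset,
        (-1 : R) ^ (Fintype.card ι - S.card) * (f S - f (insert a S)) := by
  conv_lhs => rw [← Finset.insert_erase (Finset.mem_univ a)]
  rw [Finset.sum_powerset_insert (Finset.notMem_erase a _), ← Finset.sum_add_distrib]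
  refine Finset.sum_congr rfl fun S hS => ?_
  have ha : a ∉ S := fun h => Finset.notMem_erase a _ (Finset.mem_powerset.mp hS h)
  have hlt := Finset.card_lt_univ_of_notMem ha
  rw [Finset.card_insert_of_notMem ha,
    show Fintype.card ι - S.card = (Fintype.card ι - (S.card + 1)) + 1 by lia, pow_succ]
  ring

/-- Abstract Composition Formula (Theorem 4.3): `{○}·{K#J} = {K}·{J}` for the
Rudolph polynomial, in combinatorial-algebraic form. -/
theorem composition_formula {R : Type*} [CommRing R] {ι κ : Type*}
    [Fintype ι] [DecidableEq ι] [Fintype κ] [DecidableEq κ]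
    (a : ι) (b : κ) (e : R) (f : Finset ι → R) (g : Finset κ → R)
    (m : Finset ι → Finset κ → R)
    (hm : ∀ S : Finset ι, a ∉ S → ∀ T : Finset κ, b ∉ T →
      (e - 1) * m S T =
        e * f S * g T + f (insert a S) * g (insert b T)
          - f S * g (insert b T) - f (insert a S) * g T) :
    (e - 1) *
      ∑ S ∈ (Finset.univ.erase a).powerset, ∑ T ∈ (Finset.univ.erase b).powerset,
        (-1 : R) ^ ((Fintype.card ι + Fintype.card κ - 1) - (S.card + T.card)) *
          (f S * g T - m S T) =
    (∑ S ∈ (Finset.univ : Finset ι).powerset, (-1 : R) ^ (Fintype.card ι - S.card) * f S) *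
    (∑ T ∈ (Finset.univ : Finset κ).powerset, (-1 : R) ^ (Fintype.card κ - T.card) * g T) := by
  rw [sum_powerset_univ_alternating_eq a f, sum_powerset_univ_alternating_eq b g,
    Finset.sum_mul_sum, Finset.mul_sum]
  refine Finset.sum_congr rfl fun S hS => ?_
  rw [Finset.mul_sum]
  refine Finset.sum_congr rfl fun T hT => ?_
  have ha : a ∉ S := fun h => Finset.notMem_erase a _ (Finset.mem_powerset.mp hS h)
  have hb : b ∉ T := fun h => Finset.notMem_erase b _ (Finset.mem_powerset.mp hT h)
  have hS_lt := Finset.card_lt_univ_of_notMem ha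
  have hT_lt := Finset.card_lt_univ_of_notMem hb
  have hsign : (-1 : R) ^ (Fintype.card ι - S.card) * (-1) ^ (Fintype.card κ - T.card) =
      -(-1) ^ ((Fintype.card ι + Fintype.card κ - 1) - (S.card + T.card)) := by
    rw [← pow_add, show Fintype.card ι - S.card + (Fintype.card κ - T.card) =
      (Fintype.card ι + Fintype.card κ - 1) - (S.card + T.card) + 1 by lia, pow_succ]
    ring
  rw [mul_mul_mul_comm, hsign]
  linear_combination
    -(-1 : R) ^ ((Fintype.card ι + Fintype.card κ - 1) - (S.card + T.card)) * hm S ha T hb
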